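/- Let (H_n) be a sequence of graphs with |H_n| = o(log n) and chromatic number χ(H_n) = r_n + 1, where r_n ≥ 2. Then for every ε > 0 and all sufficiently large n, (1 - 1/r_n)·C(n,2) ≤ log₂ |P_n(H_n)| ≤ (1 - 1/r_n + ε)·C(n,2). -/

import Mathlib

open SimpleGraph Filter

/-- `H` is contained in `G` as a (not necessarily induced) subgraph. -/
def Contains {α β : Type*} (H : SimpleGraph α) (G : SimpleGraph β) : Prop :=
  ∃ f : H →g G, Function.Injective f

/-! ### Blow-ups of cliques in clique-dense graphs -/

/-- If a set of `s`-cliques of `G`, viewed as tuples, has positive density `1 / q`, then `G` contains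
a complete `s`-partite graph with parts of logarithmic size whose diagonal cliques belong
to the set. -/
theorem exists_blowup_of_dense (s : ℕ) : ∀ q : ℕ, 0 < q → ∃ K : ℕ, ∀ t : ℕ, 0 < t →
    ∀ (V : Type) [Fintype V] (G : SimpleGraph V) (R : Finset (Fin s → V)),
    K ^ t ≤ Fintype.card V → (∀ x ∈ R, ∀ i j, i ≠ j → G.Adj (x i) (x j)) →
    Fintype.card V ^ s ≤ q * R.card →
    ∃ f : Fin s → Fin t → V, (∀ i, Function.Injective (f i)) ∧
      (∀ i i', i ≠ i' → ∀ j j', G.Adj (f i j) (f i' j')) ∧ ∀ j, (fun i => f i j) ∈ R := by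
  classical
  induction s with
  | zero =>
    intro q hq
    refine ⟨1, fun t _ V _ G R _ _ hR => ⟨fun i => i.elim0, fun i => i.elim0, fun i => i.elim0, ?_⟩⟩
    intro j
    have hne : R.Nonempty := by
      rw [Finset.nonempty_iff_ne_empty]
      rintro rfl
      simp at hR
    obtain ⟨x, hx⟩ := hne
    convert hx
  | succ s ih =>
    intro q hq
    obtain ⟨K, hK⟩ := ih (2 * q) (by positivity)
    refine ⟨max (K ^ (4 * q)) (2 ^ (8 * q)), fun t ht V _ G R hn hcl hR => ?_⟩
    set n := Fintype.card V with hn_def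
    have hn1 : K ^ (4 * q * t) ≤ n := by
      rw [pow_mul]; exact (Nat.pow_le_pow_left (le_max_left _ _) t).trans hn
    have hn2 : 2 ^ (8 * q * t) ≤ n := by
      rw [pow_mul]; exact (Nat.pow_le_pow_left (le_max_right _ _) t).trans hn
    have hn0 : 0 < n := lt_of_lt_of_le (by positivity) hn2
    let D : (Fin s → V) → Finset V := fun x => {v | (Fin.cons v x : Fin (s + 1) → V) ∈ R}
    have hRsum : R.card = ∑ x, (D x).card := by
      rw [← Finset.card_sigma]
      refine Finset.card_bij (fun y _ => ⟨Fin.tail y, y 0⟩) ?_ ?_ ?_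
      · intro y hy
        simpa [D] using hy
      · intro y _ z _ h
        simp only [Sigma.mk.injEq, heq_eq_eq] at h
        rw [← Fin.cons_self_tail y, ← Fin.cons_self_tail z, h.1, h.2]
      · rintro ⟨x, v⟩ hx
        exact ⟨Fin.cons v x, by simpa [D] using hx, by simp⟩
    let R' : Finset (Fin s → V) := {x | n ≤ 2 * q * (D x).card}
    have hR' : n ^ s ≤ 2 * q * R'.card := by
      have h1 : ∀ x, 2 * q * (D x).card ≤ (if x ∈ R' then 2 * q * n else 0) + n := by
        intro x
        split_ifs with h
        · exact (Nat.mul_le_mul_left _ (Finset.card_le_univ _)).trans (Nat.le_add_right _ _)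
        · simp only [R', Finset.mem_filter, Finset.mem_univ, true_and, not_le] at h
          lia
      have h2 : 2 * q * R.card ≤ R'.card * (2 * q * n) + n ^ s * n := by
        rw [hRsum, Finset.mul_sum]
        refine (Finset.sum_le_sum fun x _ => h1 x).trans ?_
        rw [Finset.sum_add_distrib, ← Finset.sum_filter]
        simp [hn_def]
      have h3 : n ^ s * n ≤ (2 * q * R'.card) * n := by
        rw [pow_succ] at hR
        nlinarith
      exact Nat.le_of_mul_le_mul_right h3 hn0
    obtain ⟨f, hinj, hadj, hmem⟩ := hK (4 * q * t) (by positivity) V G R' hn1 (by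
      intro x hx i j hij
      simp only [R', Finset.mem_filter, Finset.mem_univ, true_and] at hx
      have : 0 < (D x).card := by
        by_contra h0
        simp only [not_lt, nonpos_iff_eq_zero] at h0
        simp [h0] at hx
        omega
      obtain ⟨v, hv⟩ := Finset.card_pos.1 this
      simp only [D, Finset.mem_filter, Finset.mem_univ, true_and] at hv
      simpa using hcl _ hv i.succ j.succ (by simpa using hij)) hR'
    let S : V → Finset (Fin (4 * q * t)) := fun v => {j | v ∈ D (fun i => f i j)}
    let W : Finset V := {v | t ≤ (S v).card}
    have hW : n ≤ 4 * q * W.card := by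
      have h1 : ∑ v, (S v).card = ∑ j, (D (fun i => f i j)).card := by
        simpa [S, Finset.bipartiteAbove, Finset.bipartiteBelow] using
          Finset.sum_card_bipartiteAbove_eq_sum_card_bipartiteBelow
          (s := (Finset.univ : Finset V)) (t := Finset.univ) (fun v j => v ∈ D (fun i => f i j))
      have h2 : 4 * q * t * n ≤ 2 * q * ∑ v, (S v).card := by
        rw [h1, Finset.mul_sum]
        calc 4 * q * t * n = ∑ _j : Fin (4 * q * t), n := by simp
          _ ≤ _ := by
            refine Finset.sum_le_sum fun j _ => ?_
            simpa [R'] using hmem j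
      have h3 : ∑ v, (S v).card ≤ W.card * (4 * q * t) + n * t := by
        have : ∀ v, (S v).card ≤ (if v ∈ W then 4 * q * t else 0) + t := by
          intro v
          split_ifs with h
          · exact ((Finset.card_le_univ _).trans (by simp)).trans (Nat.le_add_right _ _)
          · simp only [W, Finset.mem_filter, Finset.mem_univ, true_and, not_le] at h
            lia
        refine (Finset.sum_le_sum fun x _ => this x).trans ?_
        rw [Finset.sum_add_distrib, ← Finset.sum_filter]
        simp [hn_def]
      have h4 : (q * t) * (2 * n) ≤ (q * t) * (4 * q * W.card + n) := by
        have := Nat.mul_le_mul_left (2 * q) h3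
        nlinarith
      have := Nat.le_of_mul_le_mul_left h4 (by positivity)
      lia
    have hW2 : (Finset.univ : Finset (Finset (Fin (4 * q * t)))).card * t ≤ W.card := by
      simp only [Finset.card_univ, Fintype.card_finset, Fintype.card_fin]
      have h1 : 4 * q * t < 2 ^ (4 * q * t) := Nat.lt_two_pow_self
      have h2 : 2 ^ (8 * q * t) = 2 ^ (4 * q * t) * 2 ^ (4 * q * t) := by
        rw [← pow_add]; congr 1; ring
      have h3 : 4 * q * (2 ^ (4 * q * t) * t) ≤ 4 * q * W.card := by
        calc 4 * q * (2 ^ (4 * q * t) * t) = 2 ^ (4 * q * t) * (4 * q * t) := by ring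
          _ ≤ 2 ^ (4 * q * t) * 2 ^ (4 * q * t) := Nat.mul_le_mul_left _ h1.le
          _ ≤ _ := by rw [← h2]; exact hn2.trans hW
      exact Nat.le_of_mul_le_mul_left h3 (by positivity)
    obtain ⟨T, -, hT⟩ := Finset.exists_le_card_fiber_of_mul_le_card_of_maps_to
      (f := S) (fun v _ => Finset.mem_univ _) ⟨∅, Finset.mem_univ _⟩ hW2
    obtain ⟨v₀, hv₀⟩ := Finset.card_pos.1 (ht.trans_le hT)
    simp only [W, Finset.mem_filter, Finset.mem_univ, true_and] at hv₀
    have hTt : t ≤ T.card := hv₀.2 ▸ hv₀.1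
    obtain ⟨e⟩ : Nonempty (Fin t ↪ T) := Function.Embedding.nonempty_of_card_le (by simpa using hTt)
    obtain ⟨g⟩ : Nonempty (Fin t ↪ {v // v ∈ W ∧ S v = T}) :=
      Function.Embedding.nonempty_of_card_le (by
        rw [Fintype.card_fin, Fintype.card_subtype]
        convert hT using 2
        ext; simp)
    have key : ∀ j j', (Fin.cons (g j : V) (fun i => f i (e j')) : Fin (s + 1) → V) ∈ R := by
      intro j j'
      have h1 : (e j' : Fin (4 * q * t)) ∈ S (g j) := by
        rw [(g j).2.2]; exact (e j').2
      simpa [S, D] using h1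
    refine ⟨Fin.cons (fun j => (g j : V)) (fun i j => f i (e j)), ?_, ?_, ?_⟩
    · intro i
      refine Fin.cases ?_ (fun i => ?_) i
      · exact Subtype.val_injective.comp g.injective
      · exact (hinj i).comp (Subtype.val_injective.comp e.injective)
    · intro i i'
      refine Fin.cases ?_ (fun i => ?_) i <;> refine Fin.cases ?_ (fun i' => ?_) i'
      · simp
      · intro _ j j'
        simpa using hcl _ (key j j') 0 i'.succ (Fin.succ_ne_zero i').symm
      · intro _ j j'
        simpa using hcl _ (key j' j) i.succ 0 (Fin.succ_ne_zero i)
      · intro h j j'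
        simpa using hadj i i' (by simpa using h) (e j) (e j')
    · intro j
      convert key j j using 1
      funext i
      refine Fin.cases ?_ (fun i => ?_) i <;> simp

/-! ### Counting cliques in dense regular tuples -/

open Classical in
/-- Every pair of subsets of `A` and `B` of relative size at least `η` has edge density at
least `d`. -/
def LowerDense {V : Type} (G : SimpleGraph V) (η d : ℝ) (A B : Finset V) : Prop :=
  ∀ A' ⊆ A, ∀ B' ⊆ B, η * A.card ≤ A'.card → η * B.card ≤ B'.card →
    d * (A'.card * B'.card) ≤ (G.interedges A' B').card

theorem LowerDense.restrict {V : Type} {G : SimpleGraph V} {η η' d c : ℝ} {A B A' B' : Finset V}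
    (h : LowerDense G η d A B) (hA : A' ⊆ A) (hB : B' ⊆ B) (hcA : c * A.card ≤ A'.card)
    (hcB : c * B.card ≤ B'.card) (hη' : 0 ≤ η') (hη : η ≤ η' * c) : LowerDense G η' d A' B' := by
  intro X hX Y hY hXA hYB
  refine h X (hX.trans hA) Y (hY.trans hB) ?_ ?_
  · calc η * A.card ≤ η' * c * A.card := by gcongr
      _ = η' * (c * A.card) := by ring
      _ ≤ η' * A'.card := by gcongr
      _ ≤ _ := hXA
  · calc η * B.card ≤ η' * c * B.card := by gcongr
      _ = η' * (c * B.card) := by ring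
      _ ≤ η' * B'.card := by gcongr
      _ ≤ _ := hYB

open Classical in
/-- In a lower-dense pair, few vertices have few neighbours. -/
theorem LowerDense.card_low_degree_le {V : Type} {G : SimpleGraph V} {η d : ℝ} {A B : Finset V}
    (h : LowerDense G η d A B) (hη : η ≤ 1) (hB : B.Nonempty) (hA : A.Nonempty) (hη0 : 0 < η) :
    (({v ∈ A | ((B.filter (G.Adj v)).card : ℝ) < d * B.card} : Finset V).card : ℝ)
      ≤ η * A.card := by
  set X : Finset V := {v ∈ A | ((B.filter (G.Adj v)).card : ℝ) < d * B.card} with hX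
  by_contra! hlt
  have hXne : X.Nonempty := by
    rw [← Finset.card_pos, ← Nat.cast_pos (α := ℝ)]
    exact lt_of_le_of_lt (by positivity) hlt
  have h1 := h X (Finset.filter_subset _ _) B subset_rfl hlt.le
    (mul_le_of_le_one_left (by positivity) hη)
  have h2 : ((G.interedges X B).card : ℝ)
      = ∑ v ∈ X, ((B.filter (G.Adj v)).card : ℝ) := by
    rw [interedges_def, Finset.card_filter, Finset.sum_product]
    simp only [← Finset.card_filter]
    push_cast
    rfl
  have h3 : ∑ v ∈ X, ((B.filter (G.Adj v)).card : ℝ) < ∑ v ∈ X, d * B.card :=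
    Finset.sum_lt_sum_of_nonempty hXne fun v hv => (Finset.mem_filter.1 hv).2
  rw [Finset.sum_const, nsmul_eq_mul] at h3
  rw [h2] at h1
  linarith

open Classical in
/-- Pairwise lower-dense sets span a positive proportion of all possible transversal cliques. -/
theorem exists_card_clique_ge_of_lowerDense (d : ℝ) (hd : 0 < d) (hd1 : d ≤ 1) (s : ℕ) :
    ∃ η : ℝ, 0 < η ∧ η ≤ 1 ∧ ∃ β : ℝ, 0 < β ∧ ∀ (V : Type) [Fintype V] (G : SimpleGraph V)
      (A : Fin s → Finset V), (∀ i j, i ≠ j → LowerDense G η d (A i) (A j)) →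
      β * ∏ i, ((A i).card : ℝ) ≤ ((Finset.univ.filter fun f : Fin s → V =>
        (∀ i, f i ∈ A i) ∧ ∀ i j, i ≠ j → G.Adj (f i) (f j)).card : ℝ) := by
  induction s with
  | zero =>
    refine ⟨1, one_pos, le_rfl, 1, one_pos, fun V _ G A _ => ?_⟩
    simp
  | succ s ih =>
    obtain ⟨η, hη, hη1, β, hβ, ih⟩ := ih
    refine ⟨min (η * d) (1 / (2 * (s + 1))), by positivity, (min_le_left _ _).trans
      (mul_le_one₀ hη1 hd.le hd1), β * d ^ s / 2, by positivity, fun V _ G A hA => ?_⟩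
    set η' := min (η * d) (1 / (2 * (s + 1) : ℝ)) with hη'
    have hη'0 : 0 < η' := by positivity
    have hη'1 : η' ≤ 1 := (min_le_left _ _).trans (mul_le_one₀ hη1 hd.le hd1)
    by_cases hne : ∀ i, (A i).Nonempty
    swap
    · push Not at hne
      obtain ⟨i, hi⟩ := hne
      rw [Finset.prod_eq_zero (Finset.mem_univ i) (by simp [hi]), mul_zero]
      positivity
    let bad : Fin s → Finset V := fun i =>
      {v ∈ A 0 | (((A i.succ).filter (G.Adj v)).card : ℝ) < d * (A i.succ).card}
    have hbad : ∀ i, ((bad i).card : ℝ) ≤ η' * (A 0).card := fun i =>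
      (hA 0 i.succ (Fin.succ_ne_zero i).symm).card_low_degree_le hη'1 (hne _) (hne _) hη'0
    let good := A 0 \ Finset.univ.biUnion bad
    have hgood : ((A 0).card : ℝ) / 2 ≤ good.card := by
      have h1 : ((Finset.univ.biUnion bad).card : ℝ) ≤ s * (η' * (A 0).card) := by
        calc ((Finset.univ.biUnion bad).card : ℝ) ≤ ∑ i, ((bad i).card : ℝ) := by
              exact_mod_cast Finset.card_biUnion_le
          _ ≤ ∑ _i : Fin s, η' * (A 0).card := Finset.sum_le_sum fun i _ => hbad i
          _ = _ := by simp
      have h2 : s * η' ≤ 1 / 2 := by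
        calc s * η' ≤ (s + 1) * (1 / (2 * (s + 1))) := by
              gcongr
              · linarith
              · exact min_le_right _ _
          _ = 1 / 2 := by field_simp
      have h3 : ((A 0).card : ℝ) ≤ good.card + (Finset.univ.biUnion bad).card := by
        exact_mod_cast (Nat.sub_le_iff_le_add.1 (Finset.le_card_sdiff (Finset.univ.biUnion bad) (A 0)))
      nlinarith [(Nat.cast_nonneg (A 0).card : (0 : ℝ) ≤ _)]
    let T : V → Finset (Fin s → V) := fun v => Finset.univ.filter fun f : Fin s → V =>
        (∀ i, f i ∈ (A i.succ).filter (G.Adj v)) ∧ ∀ i j, i ≠ j → G.Adj (f i) (f j)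
    have hT : ∀ v ∈ good, β * d ^ s * ∏ i : Fin s, ((A i.succ).card : ℝ) ≤ (T v).card := by
      intro v hv
      have hdeg : ∀ i : Fin s, d * (A i.succ).card ≤ (((A i.succ).filter (G.Adj v)).card : ℝ) := by
        intro i
        by_contra! hlt
        simp only [good, Finset.mem_sdiff, Finset.mem_biUnion, not_exists] at hv
        exact hv.2 i ⟨Finset.mem_univ _, Finset.mem_filter.2 ⟨hv.1, hlt⟩⟩
      refine le_trans ?_ (ih V G (fun i => (A i.succ).filter (G.Adj v)) fun i j hij =>
        (hA i.succ j.succ (by simpa using hij)).restrict (Finset.filter_subset _ _)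
          (Finset.filter_subset _ _) (hdeg i) (hdeg j) hη.le (min_le_left _ _))
      rw [mul_assoc]
      gcongr
      calc d ^ s * ∏ i : Fin s, ((A i.succ).card : ℝ) = ∏ i : Fin s, d * ((A i.succ).card : ℝ) := by
            rw [Finset.prod_mul_distrib]; simp
        _ ≤ _ := Finset.prod_le_prod (fun i _ => by positivity) fun i _ => hdeg i
    calc β * d ^ s / 2 * ∏ i, ((A i).card : ℝ)
        = (A 0).card / 2 * (β * d ^ s * ∏ i : Fin s, ((A i.succ).card : ℝ)) := by
          rw [Fin.prod_univ_succ]; ring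
      _ ≤ good.card * (β * d ^ s * ∏ i : Fin s, ((A i.succ).card : ℝ)) := by gcongr
      _ = ∑ _v ∈ good, (β * d ^ s * ∏ i : Fin s, ((A i.succ).card : ℝ)) := by simp
      _ ≤ ∑ v ∈ good, ((T v).card : ℝ) := Finset.sum_le_sum hT
      _ = ((good.sigma T).card : ℝ) := by rw [Finset.card_sigma]; push_cast; rfl
      _ ≤ _ := by
        norm_cast
        refine Finset.card_le_card_of_injOn (fun x => Fin.cons x.1 x.2) ?_ ?_
        · rintro ⟨v, f⟩ hvf
          simp only [T, good, Finset.coe_sigma, Set.mem_sigma_iff, Finset.mem_coe, Finset.mem_sdiff,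
            Finset.mem_filter, Finset.mem_univ, true_and] at hvf
          obtain ⟨⟨hv, -⟩, hf, hadj⟩ := hvf
          simp only [Finset.coe_filter, Finset.mem_univ, true_and, Set.mem_ofPred_eq]
          refine ⟨fun i => ?_, fun i j => ?_⟩
          · refine Fin.cases ?_ (fun i => ?_) i
            · simpa using hv
            · simpa using (hf i).1
          · refine Fin.cases ?_ (fun i => ?_) i <;> refine Fin.cases ?_ (fun j => ?_) j
            · simp
            · intro _
              simpa using (hf j).2
            · intro _
              simpa using (hf i).2.symm
            · intro h
              simpa using hadj i j (by simpa using h)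
        · rintro ⟨v, f⟩ _ ⟨w, g⟩ _ h
          obtain ⟨rfl, rfl⟩ := Fin.cons_injective2 h
          rfl

/-! ### Containers for graphs with few cliques -/

open Classical in
theorem IsUniform.lowerDense {V : Type} {G : SimpleGraph V} {ε d : ℝ} {A B : Finset V}
    (h : G.IsUniform ε A B) (hd : d + ε ≤ G.edgeDensity A B) : LowerDense G ε d A B := by
  intro A' hA B' hB hcA hcB
  have h1 := abs_lt.1 (h hA hB (by linarith) (by linarith))
  have h2 : d ≤ G.edgeDensity A' B' := by linarith
  rw [edgeDensity_def] at h2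
  push_cast at h2
  rcases eq_or_lt_of_le (show (0 : ℝ) ≤ A'.card * B'.card by positivity) with h0 | h0
  · rw [← h0]; simp
  · exact (le_div_iff₀ h0).1 h2

open Classical in
/-- A graph with few `s`-cliques is, up to few edges, contained in the blow-up of a `K_s`-free graph
on boundedly many vertices. -/
theorem exists_container (s : ℕ) (γ : ℝ) (hγ : 0 < γ) (hγ1 : γ ≤ 1) :
    ∃ β : ℝ, 0 < β ∧ ∃ M N : ℕ, ∀ n ≥ N, ∀ G : SimpleGraph (Fin n),
      ((Finset.univ.filter fun f : Fin s → Fin n =>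
        ∀ i j, i ≠ j → G.Adj (f i) (f j)).card : ℝ) < β * (n : ℝ) ^ s →
      ∃ (p : Fin n → Fin M) (R : SimpleGraph (Fin M)), (R.comap p).CliqueFree s ∧
        ((G.edgeFinset \ (R.comap p).edgeFinset).card : ℝ) ≤ γ * (n : ℝ) ^ 2 := by
  obtain ⟨η, hη, hη1, β, hβ, hcount⟩ :=
    exists_card_clique_ge_of_lowerDense (γ / 16) (by positivity) (by linarith) s
  set ε := min η (γ / 16) with hε_def
  have hε : 0 < ε := by positivity
  set l := ⌈4 / γ⌉₊
  set M := SzemerediRegularity.bound ε l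
  have hM : 0 < M := SzemerediRegularity.bound_pos _ _
  refine ⟨β * (1 / (2 * M)) ^ s, by positivity, M, l + 1, fun n hn G hG => ?_⟩
  obtain ⟨P, hP, hPl, hPM, hPu⟩ := szemeredi_regularity (l := l) G hε (by simp; omega)
  have : Nonempty (Fin n) := ⟨⟨0, by omega⟩⟩
  obtain ⟨c⟩ : Nonempty (P.parts ↪ Fin M) :=
    Function.Embedding.nonempty_of_card_le (by simpa using hPM)
  have hpart : ∀ x, P.part x ∈ P.parts := fun x => P.part_mem.2 (Finset.mem_univ x)
  let Q : Finset (Fin n) → Finset (Fin n) → Prop := fun U W =>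
    U ≠ W ∧ G.IsUniform ε U W ∧ γ / 8 ≤ G.edgeDensity U W
  obtain ⟨p, R, hR⟩ : ∃ (p : Fin n → Fin M) (R : SimpleGraph (Fin M)),
      ∀ x y, (R.comap p).Adj x y ↔ Q (P.part x) (P.part y) := by
    refine ⟨fun x => c ⟨P.part x, hpart x⟩,
      { Adj := fun i j => ∃ U W : P.parts, c U = i ∧ c W = j ∧ Q U W
        symm := ⟨?_⟩
        loopless := ⟨?_⟩ }, fun x y => ⟨?_, fun h => ⟨_, _, rfl, rfl, h⟩⟩⟩
    · rintro i j ⟨U, W, hU, hW, hne, hu, hd⟩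
      exact ⟨W, U, hW, hU, hne.symm, hu.symm, by rwa [edgeDensity_comm]⟩
    · rintro i ⟨U, W, hU, hW, hne, -⟩
      exact hne (congrArg Subtype.val (c.injective (hU.trans hW.symm)))
    · rintro ⟨U, W, hU, hW, h⟩
      rwa [c.injective hU, c.injective hW] at h
  refine ⟨p, R, ?_, ?_⟩
  · by_contra hcl
    obtain ⟨f⟩ := (not_cliqueFree_iff_top_isContained _).1 hcl
    have h1 := hcount (Fin n) G (fun i => P.part (f i)) (by
      intro i j hij
      have hadj : (R.comap p).Adj (f i) (f j) := f.toHom.map_adj hij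
      obtain ⟨-, hu, hd⟩ := (hR _ _).1 hadj
      have := IsUniform.lowerDense (d := γ / 16) hu (by
        have := min_le_right η (γ / 16)
        linarith)
      intro A' hA B' hB hcA hcB
      refine this A' hA B' hB (le_trans ?_ hcA) (le_trans ?_ hcB) <;>
      · gcongr
        exact min_le_left _ _)
    have h2 : ∀ x, (n : ℝ) * (1 / (2 * M)) ≤ (P.part x).card := by
      intro x
      have hk := (Finset.card_pos.2 ⟨_, hpart x⟩)
      have h3 := hP.average_le_card_part (hpart x)
      have h4 : P.parts.card ≤ n := by simpa using P.card_parts_le_card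
      simp only [Finset.card_univ, Fintype.card_fin] at h3
      have h5 : n ≤ 2 * P.parts.card * (n / P.parts.card) := by
        have h6 := Nat.div_add_mod n P.parts.card
        have h7 := Nat.mod_lt n hk
        have h8 : 1 ≤ n / P.parts.card := (Nat.one_le_div_iff hk).2 h4
        nlinarith
      have h6 : (n : ℝ) ≤ 2 * M * (P.part x).card := by
        exact_mod_cast h5.trans (Nat.mul_le_mul (Nat.mul_le_mul_left _ hPM) h3)
      rw [mul_one_div, div_le_iff₀ (by positivity)]
      linarith
    have h3 : ((n : ℝ) * (1 / (2 * M))) ^ s ≤ ∏ i, ((P.part (f i)).card : ℝ) := by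
      calc ((n : ℝ) * (1 / (2 * M))) ^ s = ∏ _i : Fin s, (n : ℝ) * (1 / (2 * M)) := by simp
        _ ≤ _ := Finset.prod_le_prod (fun _ _ => by positivity) fun i _ => h2 _
    have h4 := h1.trans (Nat.cast_le.2 (Finset.card_le_card (t := Finset.univ.filter
      fun f : Fin s → Fin n => ∀ i j, i ≠ j → G.Adj (f i) (f j)) fun g => by
        simp only [Finset.mem_filter]
        tauto))
    have h5 : β * ((n : ℝ) * (1 / (2 * M))) ^ s ≤ β * ∏ i, ((P.part (f i)).card : ℝ) := by gcongr
    rw [mul_pow] at h5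
    linarith
  · let X := (P.nonUniforms G ε).biUnion fun (U, W) ↦ U ×ˢ W
    let Y := P.parts.biUnion Finset.offDiag
    let Z := (P.sparsePairs G (γ / 8)).biUnion fun (U, W) ↦ G.interedges U W
    have hsub : (Finset.univ.filter fun (x, y) => (G \ R.comap p).Adj x y) ⊆ X ∪ Y ∪ Z := by
      rintro ⟨x, y⟩
      simp only [Finset.mem_filter, Finset.mem_univ, true_and, sdiff_adj, hR]
      rintro ⟨hxy, hnQ⟩
      have hx := P.mem_part (Finset.mem_univ x)
      have hy := P.mem_part (Finset.mem_univ y)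
      simp only [X, Y, Z, Finset.mem_union, Finset.mem_biUnion, Prod.exists, Finset.mem_product,
        Finpartition.mk_mem_nonUniforms, Finpartition.mk_mem_sparsePairs, mem_interedges_iff,
        Finset.mem_offDiag]
      by_cases hne : P.part x = P.part y
      · exact .inl (.inr ⟨_, hpart x, hx, hne ▸ hy, hxy.ne⟩)
      by_cases hu : G.IsUniform ε (P.part x) (P.part y)
      · refine .inr ⟨_, _, ⟨hpart x, hpart y, hne, ?_⟩, hx, hy, hxy⟩
        by_contra! hd
        exact hnQ ⟨hne, hu, hd⟩
      · exact .inl (.inl ⟨_, _, ⟨hpart x, hpart y, hne, hu⟩, hx, hy⟩)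
    have hX : (X.card : ℝ) < 4 * ε * n ^ 2 := by
      simpa using hP.sum_nonUniforms_lt Finset.univ_nonempty hε hPu
    have hY : (Y.card : ℝ) ≤ γ / 2 * n ^ 2 := by
      simpa using hP.card_biUnion_offDiag_le (𝕜 := ℝ) hγ ((Nat.le_ceil _).trans (by exact_mod_cast hPl))
    have hZ : (Z.card : ℝ) ≤ 4 * (γ / 8) * n ^ 2 := by
      simpa using hP.card_interedges_sparsePairs_le (G := G) (ε := γ / 8) (by positivity)
    have hcard : (2 * (G.edgeFinset \ (R.comap p).edgeFinset).card : ℝ)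
        ≤ X.card + Y.card + Z.card := by
      norm_cast
      rw [← edgeFinset_sdiff]
      have := (two_mul_card_edgeFinset (G \ R.comap p)).trans_le ((Finset.card_le_card hsub).trans
        ((Finset.card_union_le _ _).trans
          (Nat.add_le_add_right (Finset.card_union_le _ _) _)))
      convert this
    have hε2 : ε ≤ γ / 16 := min_le_right _ _
    have : 4 * ε * (n : ℝ) ^ 2 ≤ 4 * (γ / 16) * n ^ 2 := by gcongr
    nlinarith [mul_nonneg hγ.le (sq_nonneg (n : ℝ))]

/-! ### Counting -/

/-- There are few subsets of size at most `k`: optimise over `m` when `k` is a small proportion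
of the size of `α`. -/
theorem card_filter_card_le {α : Type*} [Fintype α] (k : ℝ) (m : ℕ) :
    ((Finset.univ.filter fun E : Finset α => (E.card : ℝ) ≤ k).card : ℝ) ≤
      2 ^ (m * k + 2 * Fintype.card α * (1 / 2) ^ m : ℝ) := by
  set x : ℝ := (1 / 2) ^ m with hx
  have hx0 : 0 < x := by positivity
  have hxr : x = 2 ^ (-m : ℝ) := by
    rw [hx, Real.rpow_neg (by norm_num), Real.rpow_natCast, one_div, inv_pow]
  have h1 : ∀ E : Finset α, (E.card : ℝ) ≤ k → 1 ≤ (2 : ℝ) ^ (m * k) * x ^ E.card := by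
    intro E hE
    rw [hxr, ← Real.rpow_natCast, ← Real.rpow_mul (by norm_num), ← Real.rpow_add (by norm_num)]
    apply Real.one_le_rpow (by norm_num)
    nlinarith [mul_le_mul_of_nonneg_left hE (Nat.cast_nonneg (α := ℝ) m)]
  have h2 : (1 + x) ^ Fintype.card α ≤ (2 : ℝ) ^ (2 * Fintype.card α * x) := by
    have h3 : 1 + x ≤ (2 : ℝ) ^ (2 * x) := by
      rw [Real.rpow_def_of_pos (by norm_num)]
      have := Real.log_two_gt_d9
      have h4 := Real.add_one_le_exp (Real.log 2 * (2 * x))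
      nlinarith
    calc (1 + x) ^ Fintype.card α ≤ ((2 : ℝ) ^ (2 * x)) ^ Fintype.card α := by gcongr
      _ = _ := by
        rw [← Real.rpow_natCast, ← Real.rpow_mul (by norm_num)]
        ring_nf
  have h3 : ∑ E : Finset α, x ^ E.card = (1 + x) ^ Fintype.card α := by
    have := Fintype.sum_pow_mul_eq_add_pow α x 1
    simpa [add_comm] using this
  rw [Real.rpow_add (by norm_num)]
  calc ((Finset.univ.filter fun E : Finset α => (E.card : ℝ) ≤ k).card : ℝ)
      = ∑ E ∈ Finset.univ.filter fun E : Finset α => (E.card : ℝ) ≤ k, (1 : ℝ) := by simp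
    _ ≤ ∑ E ∈ Finset.univ.filter fun E : Finset α => (E.card : ℝ) ≤ k,
          (2 : ℝ) ^ (m * k) * x ^ E.card :=
        Finset.sum_le_sum fun E hE => h1 E (Finset.mem_filter.1 hE).2
    _ ≤ ∑ E : Finset α, (2 : ℝ) ^ (m * k) * x ^ E.card :=
        Finset.sum_le_sum_of_subset_of_nonneg (Finset.filter_subset _ _) fun _ _ _ => by positivity
    _ ≤ _ := by
        rw [← Finset.mul_sum, h3]
        gcongr

open Classical in
/-- Count graphs having at most `k` edges outside a fixed graph `B`. -/
theorem card_filter_card_edgeFinset_sdiff_le {V : Type*} [Fintype V] (B : SimpleGraph V) (k : ℝ) :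
    (Finset.univ.filter fun G : SimpleGraph V =>
        ((G.edgeFinset \ B.edgeFinset).card : ℝ) ≤ k).card ≤
      2 ^ B.edgeFinset.card *
        (Finset.univ.filter fun E : Finset (Sym2 V) => (E.card : ℝ) ≤ k).card := by
  rw [← Finset.card_powerset, ← Finset.card_product]
  refine Finset.card_le_card_of_injOn
    (fun G => (G.edgeFinset ∩ B.edgeFinset, G.edgeFinset \ B.edgeFinset)) ?_ ?_
  · intro G hG
    simpa using hG
  · intro G _ G' _ h
    obtain ⟨h1, h2⟩ := Prod.mk.inj h
    rw [← edgeFinset_inj, ← Finset.sdiff_union_inter G.edgeFinset B.edgeFinset, h1, h2,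
      Finset.sdiff_union_inter]

theorem CliqueFree.card_edgeFinset_le_mul_sq {V : Type*} [Fintype V] {G : SimpleGraph V}
    [DecidableRel G.Adj] {r : ℕ} (hr : 0 < r) (hG : G.CliqueFree (r + 1)) :
    (G.edgeFinset.card : ℝ) ≤ (1 - 1 / r) * (Fintype.card V : ℝ) ^ 2 / 2 := by
  have h1 := hG.card_edgeFinset_le
  simp only [← card_edgeFinset_turanGraph] at h1
  have h2 := (Nat.mul_le_mul_left (2 * r) h1).trans mul_card_edgeFinset_turanGraph_le
  have h3 : (2 * r * G.edgeFinset.card : ℝ) ≤ (r - 1) * (Fintype.card V : ℝ) ^ 2 := by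
    have := (Nat.cast_le (α := ℝ)).2 h2
    push_cast [Nat.cast_sub hr] at this
    exact this
  have hr' : (0 : ℝ) < r := by exact_mod_cast hr
  rw [one_sub_div hr'.ne', div_mul_eq_mul_div, div_div, le_div_iff₀ (by positivity)]
  linarith

theorem contains_of_blowup {s n t : ℕ} {H : SimpleGraph (Fin t)} {G : SimpleGraph (Fin n)}
    (hH : H.Colorable s) {f : Fin s → Fin t → Fin n} (hf : ∀ i, Function.Injective (f i))
    (hG : ∀ i i', i ≠ i' → ∀ j j', G.Adj (f i j) (f i' j')) : Contains H G := by
  obtain ⟨c⟩ := hH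
  refine ⟨⟨fun v => f (c v) v, fun h => hG _ _ (c.valid h) _ _⟩, fun v w h => ?_⟩
  change f (c v) v = f (c w) w at h
  by_cases hvw : c v = c w
  · rw [hvw] at h
    exact hf _ h
  · exact absurd h (hG _ _ hvw v w).ne

open Classical in
/-- The upper bound for a fixed number of colours, uniform over all `H` on at most logarithmically
many vertices. -/
theorem exists_logb_card_le {r : ℕ} (hr : 0 < r) {ε : ℝ} (hε : 0 < ε) :
    ∃ K N : ℕ, ∀ n ≥ N, ∀ t, 0 < t → K ^ t ≤ n → ∀ H : SimpleGraph (Fin t), H.Colorable (r + 1) →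
      Real.logb 2 (Nat.card {G : SimpleGraph (Fin n) // ¬ Contains H G}) ≤
        (1 - 1 / (r : ℝ) + ε) * (n.choose 2 : ℝ) := by
  obtain ⟨m, hm⟩ := exists_pow_lt_of_lt_one (show 0 < ε / 32 by positivity)
    (show (1 / 2 : ℝ) < 1 by norm_num)
  set γ : ℝ := min 1 (ε / (16 * (m + 1)))
  have hγ : 0 < γ := by positivity
  have hmγ : m * γ ≤ ε / 16 := by
    have h1 : γ ≤ ε / (16 * (m + 1)) := min_le_right _ _
    rw [le_div_iff₀ (by positivity)] at h1
    linarith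
  obtain ⟨β, hβ, M, N, hcont⟩ := exists_container (r + 1) γ hγ (min_le_left _ _)
  obtain ⟨K, hK⟩ := exists_blowup_of_dense (r + 1) ⌈1 / β⌉₊ (Nat.ceil_pos.2 (by positivity))
  set L := Fintype.card (SimpleGraph (Fin M))
  refine ⟨K, max (max N 2) ⌈8 * (M + L + 1) / ε⌉₊, fun n hn t ht hKt H hH => ?_⟩
  have hnN : N ≤ n := by omega
  have hn2 : (2 : ℝ) ≤ n := by exact_mod_cast (show 2 ≤ n by omega)
  have hnε : 8 * (M + L + 1) / ε ≤ n := Nat.ceil_le.1 (by omega)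
  rw [div_le_iff₀ hε] at hnε
  have hr' : (1 : ℝ) ≤ r := by exact_mod_cast hr
  have hr1 : 0 ≤ 1 - 1 / (r : ℝ) := by
    rw [sub_nonneg]
    exact (div_le_one (by linarith)).2 hr'
  have hr2 : 1 - 1 / (r : ℝ) ≤ 1 := by
    have : 0 ≤ 1 / (r : ℝ) := by positivity
    linarith
  let S : Finset ((Fin n → Fin M) × SimpleGraph (Fin M)) :=
    Finset.univ.filter fun x => (x.2.comap x.1).CliqueFree (r + 1)
  let F : (Fin n → Fin M) × SimpleGraph (Fin M) → Finset (SimpleGraph (Fin n)) := fun x =>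
    Finset.univ.filter fun G =>
      ((G.edgeFinset \ (x.2.comap x.1).edgeFinset).card : ℝ) ≤ γ * (n : ℝ) ^ 2
  have hcover : (Finset.univ.filter fun G : SimpleGraph (Fin n) => ¬ Contains H G) ⊆
      S.biUnion F := by
    intro G hG
    have hG := (Finset.mem_filter.1 hG).2
    obtain ⟨p, R, hR, hGR⟩ := hcont n hnN G (by
      by_contra! hdense
      obtain ⟨f, hf, hfG, -⟩ := hK t ht (Fin n) G (Finset.univ.filter fun f : Fin (r + 1) → Fin n =>
        ∀ i j, i ≠ j → G.Adj (f i) (f j)) (by simpa using hKt)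
        (fun x hx => (Finset.mem_filter.1 hx).2) (by
          rw [← Nat.cast_le (α := ℝ)]
          push_cast
          rw [Fintype.card_fin]
          calc (n : ℝ) ^ (r + 1) = 1 / β * (β * (n : ℝ) ^ (r + 1)) := by field_simp
            _ ≤ _ := by
              gcongr
              exact Nat.le_ceil _)
      exact hG (contains_of_blowup hH hf hfG))
    exact Finset.mem_biUnion.2 ⟨(p, R), by simpa [S] using hR, by simpa [F] using hGR⟩
  have hF : ∀ x ∈ S, ((F x).card : ℝ) ≤ 2 ^ ((1 - 1 / (r : ℝ)) * (n : ℝ) ^ 2 / 2 +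
      (m * (γ * (n : ℝ) ^ 2) + 2 * (n : ℝ) ^ 2 * (1 / 2) ^ m)) := by
    intro x hx
    have h1 : (F x).card ≤ 2 ^ (x.2.comap x.1).edgeFinset.card * (Finset.univ.filter
        fun E : Finset (Sym2 (Fin n)) => (E.card : ℝ) ≤ γ * (n : ℝ) ^ 2).card := by
      convert card_filter_card_edgeFinset_sdiff_le (x.2.comap x.1) (γ * (n : ℝ) ^ 2)
    have h2 := CliqueFree.card_edgeFinset_le_mul_sq hr (Finset.mem_filter.1 hx).2
    have h3 := card_filter_card_le (α := Sym2 (Fin n)) (γ * (n : ℝ) ^ 2) m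
    have h4 : (Fintype.card (Sym2 (Fin n)) : ℝ) ≤ (n : ℝ) ^ 2 := by
      rw [Sym2.card, Fintype.card_fin, Nat.cast_choose_two]
      push_cast
      nlinarith
    rw [Fintype.card_fin] at h2
    rw [Real.rpow_add (by norm_num)]
    refine (Nat.cast_le (α := ℝ).2 h1).trans ?_
    push_cast
    refine mul_le_mul ?_ (h3.trans ?_) (by positivity) (by positivity)
    · rw [← Real.rpow_natCast]
      exact Real.rpow_le_rpow_of_exponent_le (by norm_num) h2
    · exact Real.rpow_le_rpow_of_exponent_le (by norm_num) (by gcongr)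
  have hS : (S.card : ℝ) ≤ 2 ^ ((M * n + L : ℝ)) := by
    have h1 : S.card ≤ 2 ^ (M * n + L) := by
      refine (Finset.card_filter_le _ _).trans ?_
      rw [Finset.card_univ, Fintype.card_prod, Fintype.card_fun, Fintype.card_fin,
        Fintype.card_fin, pow_add, pow_mul]
      gcongr <;> exact Nat.lt_two_pow_self.le
    have h2 := (Nat.cast_le (α := ℝ)).2 h1
    push_cast at h2
    exact_mod_cast h2
  have hchoose : (n.choose 2 : ℝ) = n * (n - 1) / 2 := Nat.cast_choose_two ℝ n
  have hcard : (Nat.card {G : SimpleGraph (Fin n) // ¬ Contains H G} : ℝ) ≤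
      2 ^ ((1 - 1 / (r : ℝ) + ε) * (n.choose 2 : ℝ)) := by
    rw [Nat.card_eq_fintype_card, Fintype.card_subtype]
    calc ((Finset.univ.filter fun G : SimpleGraph (Fin n) => ¬ Contains H G).card : ℝ)
        ≤ (S.biUnion F).card := by exact_mod_cast Finset.card_le_card hcover
      _ ≤ ∑ x ∈ S, ((F x).card : ℝ) := by exact_mod_cast Finset.card_biUnion_le
      _ ≤ _ := Finset.sum_le_card_nsmul _ _ _ hF
      _ ≤ 2 ^ ((M * n + L : ℝ)) * 2 ^ ((1 - 1 / (r : ℝ)) * (n : ℝ) ^ 2 / 2 +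
            (m * (γ * (n : ℝ) ^ 2) + 2 * (n : ℝ) ^ 2 * (1 / 2) ^ m)) := by
          rw [nsmul_eq_mul]
          gcongr
      _ ≤ _ := by
          rw [← Real.rpow_add (by norm_num)]
          apply Real.rpow_le_rpow_of_exponent_le (by norm_num)
          rw [hchoose]
          have e1 : m * (γ * (n : ℝ) ^ 2) ≤ ε / 16 * n ^ 2 := by
            rw [← mul_assoc]; gcongr
          have e2 : 2 * (n : ℝ) ^ 2 * (1 / 2) ^ m ≤ ε / 16 * n ^ 2 := by
            nlinarith [sq_nonneg (n : ℝ)]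
          have e3 : (1 - 1 / (r : ℝ)) * n ≤ n := by nlinarith
          have e4 : (L : ℝ) ≤ L * n := le_mul_of_one_le_right (by positivity) (by linarith)
          have e5 : 8 * (M + L + 1) * (n : ℝ) ≤ n * ε * n := by gcongr
          have e6 : ε * n * 2 ≤ ε * n * n := by gcongr
          nlinarith
  rcases Nat.eq_zero_or_pos (Nat.card {G : SimpleGraph (Fin n) // ¬ Contains H G}) with h0 | h0
  · rw [h0, Nat.cast_zero, Real.logb_zero]
    positivity
  · exact (Real.logb_le_iff_le_rpow (by norm_num) (by exact_mod_cast h0)).2 hcard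

/-! ### The lower bound -/

theorem mul_choose_two_le_card_edgeFinset_turanGraph {r : ℕ} (hr : 0 < r) (n : ℕ) :
    (1 - 1 / (r : ℝ)) * (n.choose 2 : ℝ) ≤ (turanGraph n r).edgeFinset.card := by
  have key : ((r : ℝ) - 1) * (n * (n - 1)) ≤ 2 * r * (turanGraph n r).edgeFinset.card := by
    induction n using Nat.strong_induction_on with
    | _ n ih =>
      have hr1 : (1 : ℝ) ≤ r := by exact_mod_cast hr
      rcases lt_or_ge n r with hn | hn
      · rw [card_edgeFinset_turanGraph, Nat.mod_eq_of_lt hn, Nat.sub_self, zero_mul, Nat.zero_div,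
          zero_add, Nat.cast_choose_two]
        have : (0 : ℝ) ≤ n.choose 2 := by positivity
        rw [Nat.cast_choose_two] at this
        linarith
      · obtain ⟨k, rfl⟩ := Nat.exists_eq_add_of_le' hn
        have h1 := ih k (by omega)
        rw [card_edgeFinset_turanGraph_add]
        push_cast [Nat.cast_choose_two, Nat.cast_sub hr]
        nlinarith [mul_nonneg (sub_nonneg.2 hr1) (Nat.cast_nonneg (α := ℝ) r)]
  have hr' : (0 : ℝ) < r := by exact_mod_cast hr
  rw [Nat.cast_choose_two, one_sub_div hr'.ne', div_mul_div_comm, div_le_iff₀ (by positivity)]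
  linarith

/-- The spanning subgraphs of an `r`-colorable graph avoid every graph that is not `r`-colorable. -/
theorem two_pow_card_edgeFinset_le {t n r : ℕ} {H : SimpleGraph (Fin t)} (hH : ¬ H.Colorable r)
    {T : SimpleGraph (Fin n)} [DecidableRel T.Adj] (hT : T.Colorable r) :
    2 ^ T.edgeFinset.card ≤ Nat.card {G : SimpleGraph (Fin n) // ¬ Contains H G} := by
  classical
  rw [← Finset.card_powerset, ← Nat.card_eq_finsetCard]
  have hedge : ∀ s : T.edgeFinset.powerset,
      (fromEdgeSet (s.1 : Set (Sym2 (Fin n)))).edgeSet = (s.1 : Set (Sym2 (Fin n))) := by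
    rintro ⟨s, hs⟩
    rw [edgeSet_fromEdgeSet, sdiff_eq_left, Set.disjoint_left]
    exact fun e he => T.not_isDiag_of_mem_edgeFinset (Finset.mem_powerset.1 hs he)
  refine Nat.card_le_card_of_injective
    (fun s => ⟨fromEdgeSet (s.1 : Set (Sym2 (Fin n))), ?_⟩) fun s s' h => ?_
  · rintro ⟨f, -⟩
    refine hH ((hT.mono_left ?_).of_hom f)
    rw [← edgeSet_subset_edgeSet, hedge, ← coe_edgeFinset]
    exact Finset.coe_subset.2 (Finset.mem_powerset.1 s.2)
  · have h' := congrArg edgeSet (Subtype.mk.inj h)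
    rw [hedge, hedge] at h'
    exact Subtype.ext (Finset.coe_injective h')

theorem le_logb_card {t n r : ℕ} (hr : 0 < r) {H : SimpleGraph (Fin t)} (hH : ¬ H.Colorable r) :
    (1 - 1 / (r : ℝ)) * (n.choose 2 : ℝ) ≤
      Real.logb 2 (Nat.card {G : SimpleGraph (Fin n) // ¬ Contains H G}) := by
  have h1 := two_pow_card_edgeFinset_le (T := turanGraph n r) hH
    ⟨Coloring.mk (fun v => ⟨v % r, Nat.mod_lt _ hr⟩) fun h => by simpa [turanGraph] using h⟩
  have h2 : 0 < Nat.card {G : SimpleGraph (Fin n) // ¬ Contains H G} :=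
    (Nat.two_pow_pos _).trans_le h1
  refine (mul_choose_two_le_card_edgeFinset_turanGraph hr n).trans ?_
  rw [Real.le_logb_iff_rpow_le (by norm_num) (by exact_mod_cast h2), Real.rpow_natCast]
  exact_mod_cast h1

theorem logb_card_le_choose_two {t n : ℕ} (H : SimpleGraph (Fin t)) :
    Real.logb 2 (Nat.card {G : SimpleGraph (Fin n) // ¬ Contains H G}) ≤ n.choose 2 := by
  classical
  have h1 : Nat.card {G : SimpleGraph (Fin n) // ¬ Contains H G} ≤ 2 ^ n.choose 2 := by
    have h2 : (⊤ : SimpleGraph (Fin n)).edgeFinset.card = n.choose 2 := by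
      simpa using card_edgeFinset_top_eq_card_choose_two (V := Fin n)
    rw [← h2, ← Finset.card_powerset, ← Nat.card_eq_finsetCard]
    refine Nat.card_le_card_of_injective
      (fun G => ⟨G.1.edgeFinset, Finset.mem_powerset.2 (edgeFinset_mono le_top)⟩) fun G G' h => ?_
    exact Subtype.ext (edgeFinset_inj.1 (Subtype.mk.inj h))
  rcases Nat.eq_zero_or_pos (Nat.card {G : SimpleGraph (Fin n) // ¬ Contains H G}) with h0 | h0
  · rw [h0, Nat.cast_zero, Real.logb_zero]
    positivity
  · rw [Real.logb_le_iff_le_rpow (by norm_num) (by exact_mod_cast h0), Real.rpow_natCast]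
    exact_mod_cast h1

theorem eventually_pow_le {h : ℕ → ℕ}
    (hsmall : (fun n => (h n : ℝ)) =o[atTop] (fun n => Real.log n)) (K : ℕ) :
    ∀ᶠ n in atTop, K ^ h n ≤ n := by
  filter_upwards [hsmall.bound (show 0 < 1 / ((K : ℝ) + 1) by positivity), eventually_ge_atTop 1]
    with n hn hn1
  have hn0 : (0 : ℝ) < n := by exact_mod_cast hn1
  have h0 : 0 ≤ Real.log n := Real.log_natCast_nonneg n
  rw [Real.norm_of_nonneg (by positivity), Real.norm_of_nonneg h0, one_div_mul_eq_div,
    le_div_iff₀ (by positivity)] at hn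
  have h1 : ((K + 1 : ℕ) : ℝ) ^ h n ≤ n := by
    rw [← Real.log_le_log_iff (by positivity) hn0, Real.log_pow]
    refine le_trans ?_ hn
    gcongr
    have := Real.log_le_sub_one_of_pos (show (0 : ℝ) < (K + 1 : ℕ) by positivity)
    push_cast at this ⊢
    linarith
  exact (Nat.pow_le_pow_left (Nat.le_succ K) _).trans (by exact_mod_cast h1)

theorem stmt4 (h : ℕ → ℕ) (H : ∀ n, SimpleGraph (Fin (h n))) (r : ℕ → ℕ)
    (hr : ∀ n, 2 ≤ r n)
    (hsmall : (fun n => (h n : ℝ)) =o[atTop] (fun n => Real.log n))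
    (hchrom : ∀ n, (H n).chromaticNumber = (r n : ℕ∞) + 1)
    (ε : ℝ) (hε : 0 < ε) :
    ∃ N : ℕ, ∀ n ≥ N,
      (1 - 1/(r n : ℝ)) * (n.choose 2 : ℝ) ≤
        Real.logb 2 (Nat.card {G : SimpleGraph (Fin n) // ¬ Contains (H n) G}) ∧
      Real.logb 2 (Nat.card {G : SimpleGraph (Fin n) // ¬ Contains (H n) G}) ≤
        (1 - 1/(r n : ℝ) + ε) * (n.choose 2 : ℝ) := by
  have hcol : ∀ n, (H n).Colorable (r n + 1) := fun n =>
    chromaticNumber_le_iff_colorable.1 (by rw [hchrom]; norm_cast)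
  have hncol : ∀ n, ¬ (H n).Colorable (r n) := fun n hn => by
    have := chromaticNumber_le_iff_colorable.2 hn
    rw [hchrom] at this
    norm_cast at this
    omega
  have hpos : ∀ n, 0 < h n := fun n => by
    by_contra! h0
    have : IsEmpty (Fin (h n)) := by
      rw [Nat.le_zero.1 h0]
      infer_instance
    exact hncol n (Colorable.of_isEmpty _)
  choose! K N hKN using fun (k : ℕ) (hk : 0 < k) => exists_logb_card_le hk hε
  have hev : ∀ᶠ n in atTop, ∀ k ∈ Finset.range ⌈1 / ε⌉₊, N k ≤ n ∧ K k ^ h n ≤ n :=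
    (Filter.eventually_all_finset _).2 fun k _ =>
      (eventually_ge_atTop (N k)).and (eventually_pow_le hsmall (K k))
  obtain ⟨N₀, hN₀⟩ := eventually_atTop.1 hev
  refine ⟨N₀, fun n hn => ⟨le_logb_card (by have := hr n; omega) (hncol n), ?_⟩⟩
  have hr0 : 0 < r n := by have := hr n; omega
  rcases lt_or_ge (r n) ⌈1 / ε⌉₊ with hlt | hge
  · obtain ⟨h1, h2⟩ := hN₀ n hn (r n) (Finset.mem_range.2 hlt)
    exact hKN (r n) hr0 n h1 (h n) (hpos n) h2 (H n) (hcol n)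
  · refine (logb_card_le_choose_two (H n)).trans (le_mul_of_one_le_left (by positivity) ?_)
    have h1 : 1 / ε ≤ r n := Nat.ceil_le.1 hge
    have h2 : 1 / (r n : ℝ) ≤ ε := by
      rw [one_div_le (by exact_mod_cast hr0) hε]
      exact h1
    linarith
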